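/- Let R be a ring (associative, with 1 ≠ 0) of stable rank 2, i.e., whenever a, b ∈ R satisfy Ra + Rb = R there exists t ∈ R such that a + tb is a unit of R. Then GL₂(R) is generated by the elementary transvections (the matrices [[1,t],[0,1]] and [[1,0],[t,1]] for t ∈ R) together with the invertible diagonal 2×2 matrices over R. -/

import Mathlib

open Matrix

/-- The elementary transvections in `GL₂(R)`. -/
def elementaryTransvections (R : Type*) [Ring R] : Set ((Matrix (Fin 2) (Fin 2) R)ˣ) :=
  { g | ∃ t : R, g.val = !![1, t; 0, 1] ∨ g.val = !![1, 0; t, 1] }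

/-- The invertible diagonal matrices in `GL₂(R)`. -/
def invertibleDiagonals (R : Type*) [Ring R] : Set ((Matrix (Fin 2) (Fin 2) R)ˣ) :=
  { g | ∃ a b : R, g.val = Matrix.diagonal ![a, b] }

/-- `R` has stable rank `2`: whenever `Ra + Rb = R` there is `t` with `a + t*b` a unit. -/
def StableRank2 (R : Type*) [Ring R] : Prop :=
  ∀ a b : R, Submodule.span R ({a, b} : Set R) = ⊤ → ∃ t : R, IsUnit (a + t * b)

/-- The upper elementary transvection with off-diagonal entry `t`. -/
def upperTransvection {R : Type*} [Ring R] (t : R) : (Matrix (Fin 2) (Fin 2) R)ˣ where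
  val := !![1, t; 0, 1]
  inv := !![1, -t; 0, 1]
  val_inv := by simp [Matrix.one_fin_two]
  inv_val := by simp [Matrix.one_fin_two]

/-- The lower elementary transvection with off-diagonal entry `t`. -/
def lowerTransvection {R : Type*} [Ring R] (t : R) : (Matrix (Fin 2) (Fin 2) R)ˣ where
  val := !![1, 0; t, 1]
  inv := !![1, 0; -t, 1]
  val_inv := by simp [Matrix.one_fin_two]
  inv_val := by simp [Matrix.one_fin_two]

/-- The first column of an invertible `2 × 2` matrix is left unimodular. -/
theorem span_first_column_eq_top {R : Type*} [Ring R] (g : (Matrix (Fin 2) (Fin 2) R)ˣ) :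
    Submodule.span R ({g.val 0 0, g.val 1 0} : Set R) = ⊤ := by
  have h : (g⁻¹.val * g.val) 0 0 = 1 := by simp
  rw [Matrix.mul_apply, Fin.sum_univ_two] at h
  exact (Ideal.eq_top_iff_one _).2 (Submodule.mem_span_pair.2 ⟨_, _, h⟩)

/-- A `2 × 2` matrix whose upper left entry becomes a unit `u` after adding `t` times the second
row to the first is reduced to a diagonal matrix by elementary transvections. -/
theorem exists_transvections_mul_eq_diagonal {R : Type*} [Ring R]
    (g : (Matrix (Fin 2) (Fin 2) R)ˣ) (t : R) (ht : IsUnit (g.val 0 0 + t * g.val 1 0)) :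
    ∃ r s a b : R, (lowerTransvection r * upperTransvection t * g * upperTransvection s).val =
      Matrix.diagonal ![a, b] := by
  obtain ⟨u, hu⟩ := ht
  set b := g.val 0 1 + t * g.val 1 1 with hb
  have hg : (upperTransvection t * g).val = !![(u : R), b; g.val 1 0, g.val 1 1] := by
    rw [Units.val_mul, Matrix.eta_fin_two g.val]
    simp [upperTransvection, hu, hb]
  refine ⟨-(g.val 1 0 * ↑u⁻¹), -(↑u⁻¹ * b), u, g.val 1 1 - g.val 1 0 * ↑u⁻¹ * b, ?_⟩
  rw [mul_assoc (lowerTransvection _), Units.val_mul, Units.val_mul, hg]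
  ext i j
  fin_cases i <;> fin_cases j <;>
    simp [lowerTransvection, upperTransvection, mul_assoc, sub_eq_neg_add]

/-- If `R` has stable rank `2` then `GL₂(R)` is generated by the elementary
transvections together with the invertible diagonal matrices. -/
theorem stableRank2_closure_eq_top (R : Type*) [Ring R] [Nontrivial R]
    (hsr : StableRank2 R) :
    Subgroup.closure (elementaryTransvections R ∪ invertibleDiagonals R) = ⊤ := by
  refine (Subgroup.eq_top_iff' _).2 fun g => ?_
  obtain ⟨t, ht⟩ := hsr _ _ (span_first_column_eq_top g)
  obtain ⟨r, s, a, b, h⟩ := exists_transvections_mul_eq_diagonal g t ht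
  have hU (x : R) : upperTransvection x ∈
      Subgroup.closure (elementaryTransvections R ∪ invertibleDiagonals R) :=
    Subgroup.subset_closure (Or.inl ⟨x, Or.inl rfl⟩)
  have hL (x : R) : lowerTransvection x ∈
      Subgroup.closure (elementaryTransvections R ∪ invertibleDiagonals R) :=
    Subgroup.subset_closure (Or.inl ⟨x, Or.inr rfl⟩)
  have hD : lowerTransvection r * upperTransvection t * g * upperTransvection s ∈
      Subgroup.closure (elementaryTransvections R ∪ invertibleDiagonals R) :=
    Subgroup.subset_closure (Or.inr ⟨a, b, h⟩)
  rwa [Subgroup.mul_mem_cancel_right _ (hU s),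
    Subgroup.mul_mem_cancel_left _ (mul_mem (hL r) (hU t))] at hD
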